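/- For all integers n, d with n/2 < d < n, A(n,d) ≥ ((n−d)/(2e))^(n−d), where e is Euler's constant. -/

import Mathlib

/-- The tree-distance between two spanning trees on `Fin n`:
`d(T₁,T₂) = n - 1 - |E₁ ∩ E₂|`. -/
noncomputable def treeDist {n : ℕ} (G H : SimpleGraph (Fin n)) : ℕ :=
  n - 1 - (G.edgeSet ∩ H.edgeSet).ncard

/-- An `(n,d)` tree-code: a finite set of (spanning) trees on `Fin n`
such that any two distinct members have tree-distance at least `d`. -/
def IsTreeCode (n d : ℕ) (C : Finset (SimpleGraph (Fin n))) : Prop :=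
  (∀ G ∈ C, G.IsTree) ∧ ∀ G ∈ C, ∀ H ∈ C, G ≠ H → d ≤ treeDist G H

/-- `A n d`: the maximum size of an `(n,d)` tree-code. -/
noncomputable def A (n d : ℕ) : ℕ :=
  sSup {m : ℕ | ∃ C : Finset (SimpleGraph (Fin n)), IsTreeCode n d C ∧ C.card = m}

/-- An `(n,d;i)` tree-code: an `(n,d)` tree-code all of whose trees contain
a common set of at least `i` edges. -/
def IsTreeCodeCommon (n d i : ℕ) (C : Finset (SimpleGraph (Fin n))) : Prop :=
  IsTreeCode n d C ∧
    ∃ E : Finset (Sym2 (Fin n)), i ≤ E.card ∧ ∀ G ∈ C, (E : Set (Sym2 (Fin n))) ⊆ G.edgeSet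

/-- `Acommon n d i`: the maximum size of an `(n,d;i)` tree-code. -/
noncomputable def Acommon (n d i : ℕ) : ℕ :=
  sSup {m : ℕ | ∃ C : Finset (SimpleGraph (Fin n)), IsTreeCodeCommon n d i C ∧ C.card = m}

open Finset in
/-- Greedy selection: if every `R`-ball has at most `B` elements, some `R`-independent
set has at least `#U / B` elements. -/
theorem exists_independent_subset {α : Type*} [DecidableEq α] (R : α → α → Prop)
    [DecidableRel R] (B : ℕ) (U : Finset α) (hrefl : ∀ x ∈ U, R x x)
    (hsymm : ∀ x y, R x y → R y x) (hB : ∀ x ∈ U, #{y ∈ U | R x y} ≤ B) :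
    ∃ C ⊆ U, (∀ x ∈ C, ∀ y ∈ C, x ≠ y → ¬ R x y) ∧ #U ≤ #C * B := by
  induction U using Finset.strongInduction with
  | H U ih =>
    rcases U.eq_empty_or_nonempty with rfl | ⟨x, hx⟩
    · exact ⟨∅, by simp⟩
    obtain ⟨C, hCU, hC, hcard⟩ := ih {y ∈ U | ¬ R x y}
      (Finset.filter_ssubset.2 ⟨x, hx, by simpa using hrefl x hx⟩)
      (fun y hy => hrefl y (Finset.mem_filter.1 hy).1)
      (fun y hy => (Finset.card_le_card
        (Finset.filter_subset_filter _ (Finset.filter_subset _ _))).trans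
          (hB y (Finset.mem_filter.1 hy).1))
    have hfar : ∀ y ∈ C, ¬ R x y := fun y hy => (Finset.mem_filter.1 (hCU hy)).2
    have hxC : x ∉ C := fun h => hfar x h (hrefl x hx)
    refine ⟨insert x C, ?_, ?_, ?_⟩
    · exact Finset.insert_subset hx (hCU.trans (Finset.filter_subset _ _))
    · intro y hy z hz hne
      obtain rfl | hy := Finset.mem_insert.1 hy <;> obtain rfl | hz := Finset.mem_insert.1 hz
      · exact absurd rfl hne
      · exact hfar z hz
      · exact fun h => hfar y ‹y ∈ C› (hsymm _ _ h)
      · exact hC y hy z hz hne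
    · rw [Finset.card_insert_of_notMem hxC, ← Finset.card_filter_add_card_filter_not (R x), add_mul,
        one_mul, add_comm (_ * _)]
      exact Nat.add_le_add (hB x hx) hcard

namespace List

variable {α : Type*}

theorem eq_of_erase_eq_of_pair_infix [DecidableEq α] {a b : α} {l l' : List α}
    (hl : l.Nodup) (hl' : l'.Nodup)
    (h : [a, b] <:+: l) (h' : [a, b] <:+: l') (he : l.erase b = l'.erase b) : l = l' := by
  obtain ⟨s, t, rfl⟩ := h
  obtain ⟨s', t', rfl⟩ := h'
  have key : ∀ s t : List α, (s ++ [a, b] ++ t).Nodup →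
      (s ++ [a, b] ++ t).erase b = s ++ a :: t ∧ a ∉ s ∧ a ∉ t := by
    intro s t hn
    have hn' := hn
    simp only [List.append_assoc, List.cons_append, List.nil_append, List.nodup_append,
      List.nodup_cons, List.mem_cons] at hn'
    refine ⟨?_, by grind, by grind⟩
    rw [List.append_assoc, List.erase_append_right _ (by grind)]
    simp only [List.cons_append, List.nil_append]
    rw [List.erase_cons_tail (by grind), List.erase_cons_head]
  obtain ⟨e, has, hat⟩ := key s t hl
  obtain ⟨e', has', hat'⟩ := key s' t' hl'
  rw [e, e', List.append_cons_inj_of_notMem has hat] at he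
  obtain ⟨rfl, -, rfl⟩ := he
  rfl

theorem eq_of_erase_eq_of_pair_infix' [DecidableEq α] {a b : α} {l l' : List α}
    (hl : l.Nodup) (hl' : l'.Nodup)
    (h : [b, a] <:+: l) (h' : [b, a] <:+: l') (he : l.erase b = l'.erase b) : l = l' := by
  have key : ∀ l : List α, l.Nodup → l.reverse.erase b = (l.erase b).reverse := by
    intro l hl
    rw [hl.erase_eq_filter, (List.nodup_reverse.2 hl).erase_eq_filter, List.filter_reverse]
  apply List.reverse_injective
  refine eq_of_erase_eq_of_pair_infix (a := a) (b := b) (List.nodup_reverse.2 hl)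
    (List.nodup_reverse.2 hl') ?_ ?_ (by rw [key l hl, key l' hl', he])
  · simpa using List.reverse_infix.2 h
  · simpa using List.reverse_infix.2 h'

theorem pair_infix_erase [DecidableEq α] {a b c : α} {l : List α} (hl : l.Nodup)
    (h : [a, b] <:+: l)
    (ha : a ≠ c) (hb : b ≠ c) : [a, b] <:+: l.erase c := by
  rw [hl.erase_eq_filter]
  simpa [ha, hb] using h.filter (· != c)

theorem exists_getD_of_pair_infix {a b x : α} {l : List α} (h : [a, b] <:+: l) :
    ∃ i, i + 1 < l.length ∧ l.getD i x = a ∧ l.getD (i + 1) x = b := by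
  obtain ⟨s, t, rfl⟩ := h
  exact ⟨s.length, by simp, by simp, by simp⟩

theorem pair_infix_getD {x : α} {l : List α} {i : ℕ} (hi : i + 1 < l.length) :
    [l.getD i x, l.getD (i + 1) x] <:+: l := by
  refine ⟨l.take i, l.drop (i + 2), ?_⟩
  rw [List.getD_eq_getElem _ _ hi, List.getD_eq_getElem _ _ (by omega : i < l.length)]
  conv_rhs => rw [← List.take_append_drop i l, List.drop_eq_getElem_cons (by omega : i < l.length),
    List.drop_eq_getElem_cons hi]
  simp

theorem getD_ne_getD {l : List α} (hl : l.Nodup) (x : α) {i j : ℕ} (hij : i < j)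
    (hj : j < l.length) : l.getD i x ≠ l.getD j x := by
  rw [getD_eq_getElem _ _ hj, getD_eq_getElem _ _ (hij.trans hj), Ne,
    hl.getElem_inj_iff]
  exact hij.ne

/-- The elements `a` and `b` are neighbours in the list `l`, in either order. -/
def Neighbours (l : List α) (a b : α) : Prop := [a, b] <:+: l ∨ [b, a] <:+: l

end List

namespace Finset

variable {α : Type*} [DecidableEq α]

/-- The orderings of a finite set, as duplicate-free lists. -/
noncomputable def orderings (V : Finset α) : Finset (List α) := V.toList.permutations.toFinset

theorem mem_orderings {V : Finset α} {l : List α} :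
    l ∈ V.orderings ↔ l.Nodup ∧ l.toFinset = V := by
  rw [orderings, List.mem_toFinset, List.mem_permutations]
  constructor
  · intro h
    exact ⟨h.nodup_iff.2 V.nodup_toList, by rw [List.toFinset_eq_of_perm _ _ h, V.toList_toFinset]⟩
  · rintro ⟨h, rfl⟩
    exact List.perm_of_nodup_nodup_toFinset_eq h (Finset.nodup_toList _) (by simp)

theorem card_orderings (V : Finset α) : #V.orderings = (#V).factorial := by
  rw [orderings, List.toFinset_card_of_nodup (List.nodup_permutations _ V.nodup_toList),
    List.length_permutations, Finset.length_toList]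

open Classical in
/-- A linear forest with `#S` edges is contained in at most `2 ^ #S * (#V - #S)!` orderings. -/
theorem card_orderings_neighbours_le (f : ℕ → α) (S : Finset ℕ) :
    ∀ V : Finset α, (∀ i ∈ S, f (i + 1) ∈ V) → (∀ i ∈ S, ∀ j ≤ i, f j ≠ f (i + 1)) →
      #{l ∈ V.orderings | ∀ i ∈ S, l.Neighbours (f i) (f (i + 1))} ≤
        2 ^ #S * (#V - #S).factorial := by
  induction S using Finset.induction_on_max with
  | empty => intro V _ _; simp [card_orderings]
  | insert i S hmax ih =>
    intro V hV hf
    have hi : i ∉ S := fun h => (hmax i h).false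
    set b := f (i + 1)
    have hbV : b ∈ V := hV i (Finset.mem_insert_self _ _)
    have hne : ∀ j ∈ S, f j ≠ b ∧ f (j + 1) ≠ b := fun j hj =>
      ⟨hf i (Finset.mem_insert_self _ _) _ (hmax j hj).le,
        hf i (Finset.mem_insert_self _ _) _ (hmax j hj)⟩
    have hrec := ih (V.erase b)
      (fun j hj => Finset.mem_erase.2 ⟨(hne j hj).2, hV j (Finset.mem_insert_of_mem hj)⟩)
      (fun j hj => hf j (Finset.mem_insert_of_mem hj))
    rw [Finset.card_erase_of_mem hbV] at hrec
    rw [Finset.card_insert_of_notMem hi, pow_succ, mul_right_comm, Nat.add_comm, ← Nat.sub_sub]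
    refine le_trans ?_ (Nat.mul_le_mul_right 2 hrec)
    rw [← Fintype.card_bool, ← Finset.card_univ, ← Finset.card_product]
    refine Finset.card_le_card_of_injOn
      (fun l => (l.erase b, decide ([f i, b] <:+: l))) ?_ ?_
    · intro l hl
      obtain ⟨hlV, hS⟩ := Finset.mem_filter.1 hl
      obtain ⟨hnd, rfl⟩ := mem_orderings.1 hlV
      refine Finset.mem_product.2 ⟨Finset.mem_filter.2 ⟨mem_orderings.2 ⟨hnd.erase b, ?_⟩, ?_⟩,
        Finset.mem_univ _⟩
      · ext x
        simp [hnd.mem_erase_iff]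
      · intro j hj
        exact (hS j (Finset.mem_insert_of_mem hj)).imp
          (fun h => List.pair_infix_erase hnd h (hne j hj).1 (hne j hj).2)
          (fun h => List.pair_infix_erase hnd h (hne j hj).2 (hne j hj).1)
    · intro l hl l' hl' heq
      obtain ⟨hlV, hS⟩ := Finset.mem_filter.1 hl
      obtain ⟨hlV', hS'⟩ := Finset.mem_filter.1 hl'
      have hnd := (mem_orderings.1 hlV).1
      have hnd' := (mem_orderings.1 hlV').1
      obtain ⟨he, hdec⟩ := Prod.mk.inj heq
      have hiff : [f i, b] <:+: l ↔ [f i, b] <:+: l' := by simpa using hdec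
      by_cases h : [f i, b] <:+: l
      · exact List.eq_of_erase_eq_of_pair_infix hnd hnd' h (hiff.1 h) he
      · exact List.eq_of_erase_eq_of_pair_infix' hnd hnd'
          ((hS i (Finset.mem_insert_self _ _)).resolve_left h)
          ((hS' i (Finset.mem_insert_self _ _)).resolve_left fun h' => h (hiff.2 h')) he

end Finset

namespace SimpleGraph

variable {α : Type*}

/-- The path visiting the elements of a list in order. -/
def ofList (l : List α) : SimpleGraph α := fromRel fun a b => [a, b] <:+: l

theorem neighbours_of_ofList_adj {l : List α} {a b : α} (h : (ofList l).Adj a b) :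
    l.Neighbours a b := (fromRel_adj _ _ _).1 h |>.2

theorem ofList_edgeSet_subset [DecidableEq α] (l : List α) (x : α) :
    (ofList l).edgeSet ⊆
      ((Finset.range (l.length - 1)).image fun i => s(l.getD i x, l.getD (i + 1) x) :
        Finset (Sym2 α)) := by
  intro e
  induction e with
  | h a b =>
    intro h
    rw [mem_edgeSet] at h
    simp only [Finset.coe_image, Set.mem_image, Finset.mem_coe, Finset.mem_range]
    rcases neighbours_of_ofList_adj h with h | h <;>
      obtain ⟨i, hi, rfl, rfl⟩ := List.exists_getD_of_pair_infix (x := x) h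
    · exact ⟨i, by omega, rfl⟩
    · exact ⟨i, by omega, Sym2.eq_swap⟩

theorem ofList_isTree [DecidableEq α] [Fintype α] [Nonempty α] {l : List α} (hl : l.Nodup)
    (huniv : l.toFinset = Finset.univ) : (ofList l).IsTree := by
  obtain ⟨x⟩ := ‹Nonempty α›
  have hlen : l.length = Fintype.card α := by
    rw [← List.toFinset_card_of_nodup hl, huniv, Finset.card_univ]
  have hreach : ∀ i < l.length, (ofList l).Reachable (l.getD 0 x) (l.getD i x) := by
    intro i
    induction i with
    | zero => exact fun _ => Reachable.refl _
    | succ i ih =>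
      intro hi
      refine (ih (by omega)).trans (Adj.reachable ?_)
      exact (fromRel_adj _ _ _).2 ⟨List.getD_ne_getD hl x i.lt_succ_self hi,
        Or.inl (List.pair_infix_getD hi)⟩
  have hconn : (ofList l).Connected := by
    refine connected_iff_exists_forall_reachable _ |>.2 ⟨l.getD 0 x, fun y => ?_⟩
    have hy : y ∈ l := by rw [← List.mem_toFinset, huniv]; exact Finset.mem_univ y
    obtain ⟨i, hi, rfl⟩ := List.getElem_of_mem hy
    simpa [hi] using hreach i hi
  have hle := hconn.card_vert_le_card_edgeSet_add_one
  have hge : Nat.card (ofList l).edgeSet ≤ l.length - 1 := by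
    rw [Nat.card_coe_set_eq]
    refine (Set.ncard_le_ncard (ofList_edgeSet_subset l x) (Finset.finite_toSet _)).trans ?_
    rw [Set.ncard_coe_finset]
    exact Finset.card_image_le.trans (Finset.card_range _).le
  refine isTree_iff_connected_and_card.2 ⟨hconn, ?_⟩
  have : 0 < Nat.card α := Nat.card_pos_iff.2 ⟨⟨x⟩, inferInstance⟩
  rw [← Nat.card_eq_fintype_card] at hlen
  omega

open Classical Finset in
/-- Few Hamiltonian paths share `k` or more edges with a given one. -/
theorem card_orderings_inter_le [DecidableEq α] [Fintype α] [Nonempty α] (k : ℕ) {m : List α}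
    (hm : m ∈ (univ : Finset α).orderings) :
    #{l ∈ (univ : Finset α).orderings | k ≤ ((ofList m).edgeSet ∩ (ofList l).edgeSet).ncard} ≤
      (Fintype.card α - 1).choose k * (2 ^ k * (Fintype.card α - k).factorial) := by
  obtain ⟨x⟩ := ‹Nonempty α›
  obtain ⟨hnd, huniv⟩ := mem_orderings.1 hm
  have hlen : m.length = Fintype.card α := by
    rw [← List.toFinset_card_of_nodup hnd, huniv, card_univ]
  set f : ℕ → α := fun i => m.getD i x
  have hsub : {l ∈ (univ : Finset α).orderings |
      k ≤ ((ofList m).edgeSet ∩ (ofList l).edgeSet).ncard} ⊆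
      ((range (Fintype.card α - 1)).powersetCard k).biUnion fun S =>
        {l ∈ (univ : Finset α).orderings | ∀ i ∈ S, l.Neighbours (f i) (f (i + 1))} := by
    intro l hl
    obtain ⟨hlo, hk⟩ := mem_filter.1 hl
    let T := {i ∈ range (Fintype.card α - 1) | s(f i, f (i + 1)) ∈ (ofList l).edgeSet}
    have hT : k ≤ #T := by
      refine hk.trans (le_trans ?_ (card_image_le (s := T) (f := fun i => s(f i, f (i + 1)))))
      rw [← Set.ncard_coe_finset]
      refine Set.ncard_le_ncard ?_ (finite_toSet _)
      rintro e ⟨hem, hel⟩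
      have := ofList_edgeSet_subset m x hem
      rw [hlen] at this
      obtain ⟨i, hi, rfl⟩ := mem_image.1 (mem_coe.1 this)
      exact mem_coe.2 (mem_image.2 ⟨i, mem_filter.2 ⟨hi, hel⟩, rfl⟩)
    obtain ⟨S, hST, hS⟩ := exists_subset_card_eq hT
    refine mem_biUnion.2 ⟨S, mem_powersetCard.2 ⟨hST.trans (filter_subset _ _), hS⟩,
      mem_filter.2 ⟨hlo, fun i hi => ?_⟩⟩
    exact neighbours_of_ofList_adj ((mem_edgeSet _).1 (mem_filter.1 (hST hi)).2)
  refine (card_le_card hsub).trans ?_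
  refine (card_biUnion_le_card_mul _ _ (2 ^ k * (Fintype.card α - k).factorial) ?_).trans ?_
  · intro S hS
    obtain ⟨hSr, rfl⟩ := mem_powersetCard.1 hS
    refine card_orderings_neighbours_le f S univ (fun _ _ => mem_univ _) fun i hi j hj => ?_
    have := mem_range.1 (hSr hi)
    exact List.getD_ne_getD hnd x (by omega) (by omega)
  · rw [card_powersetCard, card_range]

end SimpleGraph

theorem IsTreeCode.card_le_A {n d : ℕ} {C : Finset (SimpleGraph (Fin n))}
    (hC : IsTreeCode n d C) : C.card ≤ A n d := by
  classical
  refine le_csSup ⟨Fintype.card (SimpleGraph (Fin n)), ?_⟩ ⟨C, hC, rfl⟩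
  rintro _ ⟨D, -, rfl⟩
  exact D.card_le_univ

open Finset Nat in
theorem factorial_le_two_pow_mul_A {n d : ℕ} (hd : 0 < d) (hdn : d < n) :
    (n - d)! ≤ 2 ^ (n - d) * A n d := by
  classical
  have : NeZero n := ⟨by omega⟩
  set k := n - d with hk
  let R : List (Fin n) → List (Fin n) → Prop := fun m l =>
    k ≤ ((SimpleGraph.ofList m).edgeSet ∩ (SimpleGraph.ofList l).edgeSet).ncard
  have htree : ∀ l ∈ (univ : Finset (Fin n)).orderings, (SimpleGraph.ofList l).IsTree := by
    intro l hl
    obtain ⟨hnd, hu⟩ := mem_orderings.1 hl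
    exact SimpleGraph.ofList_isTree hnd hu
  have hrefl : ∀ l ∈ (univ : Finset (Fin n)).orderings, R l l := by
    intro l hl
    have := (SimpleGraph.isTree_iff_connected_and_card.1 (htree l hl)).2
    rw [Nat.card_coe_set_eq, Nat.card_fin] at this
    simp only [R, Set.inter_self]
    omega
  obtain ⟨C, hCU, hC, hcard⟩ := exists_independent_subset R
    ((n - 1).choose k * (2 ^ k * (n - k)!)) (univ : Finset (Fin n)).orderings hrefl
    (fun m l h => by simpa only [R, Set.inter_comm] using h)
    (fun m hm => by simpa [R] using SimpleGraph.card_orderings_inter_le k hm)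
  have hinj : Set.InjOn SimpleGraph.ofList (C : Set (List (Fin n))) := by
    intro m hm l hl h
    by_contra hne
    refine hC m hm l hl hne ?_
    have := hrefl m (hCU hm)
    simp only [R] at this ⊢
    rwa [← h]
  have hcode : IsTreeCode n d (C.image SimpleGraph.ofList) := by
    constructor
    · intro G hG
      obtain ⟨l, hl, rfl⟩ := mem_image.1 hG
      exact htree l (hCU hl)
    · intro G hG H hH hne
      obtain ⟨m, hm, rfl⟩ := mem_image.1 hG
      obtain ⟨l, hl, rfl⟩ := mem_image.1 hH
      have := hC m hm l hl fun h => hne (by rw [h])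
      simp only [R, not_le] at this
      unfold treeDist
      omega
  have hA : #C ≤ A n d := by
    rw [← Finset.card_image_of_injOn hinj]
    exact hcode.card_le_A
  rw [card_orderings, Finset.card_univ, Fintype.card_fin] at hcard
  have hchoose : (n - 1).choose k * k ! * (n - k)! ≤ n ! := by
    have h1 := Nat.choose_mul_factorial_mul_factorial (n := n - 1) (k := k) (by omega)
    have h2 : (n - k)! = (n - k) * (n - 1 - k)! := by
      rw [← Nat.mul_factorial_pred (by omega : n - k ≠ 0)]
      congr 2
      omega
    rw [← Nat.mul_factorial_pred (by omega : n ≠ 0), ← h1, h2, mul_left_comm]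
    exact Nat.mul_le_mul_right _ (Nat.sub_le _ _)
  refine Nat.le_of_mul_le_mul_left ?_ (Nat.factorial_pos n)
  calc n ! * k ! ≤ #C * ((n - 1).choose k * (2 ^ k * (n - k)!)) * k ! :=
        Nat.mul_le_mul_right _ hcard
    _ = (n - 1).choose k * k ! * (n - k)! * (2 ^ k * #C) := by ring
    _ ≤ n ! * (2 ^ k * A n d) := by gcongr

theorem stmt16 (n d : ℕ) (hd1 : n < 2 * d) (hd2 : d < n) :
    (((n : ℝ) - d) / (2 * Real.exp 1)) ^ (n - d) ≤ (A n d : ℝ) := by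
  have hA : (((n - d).factorial : ℕ) : ℝ) ≤ 2 ^ (n - d) * A n d := by
    exact_mod_cast factorial_le_two_pow_mul_A (by omega) hd2
  rw [← Nat.cast_sub hd2.le, div_pow, mul_pow, div_le_iff₀ (by positivity)]
  generalize n - d = k at *
  have hexp := Real.pow_div_factorial_le_exp (k : ℝ) k.cast_nonneg k
  rw [div_le_iff₀ (by positivity), ← Real.exp_one_pow] at hexp
  calc (k : ℝ) ^ k ≤ Real.exp 1 ^ k * k.factorial := hexp
    _ ≤ Real.exp 1 ^ k * (2 ^ k * A n d) := by gcongr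
    _ = A n d * (2 ^ k * Real.exp 1 ^ k) := by ring
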